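/- arXiv:1811.00604 — 7 statements merged into one kernel-verified Lean document; each statement's English description precedes it below -/
import Mathlib

section
/- Let m1 and m2 be positive integers, let m3 = lcm(m1, m2), d1 = m3/m1, d2 = m3/m2. Let a and b be integers such that m3 divides d1·a + d2·b. Set r1 = gcd(m1, a), r2 = gcd(m2, b), and r0 = gcd(r1, r2). Then d1·r1 = d2·r2 = d1·d2·r0. -/
theorem Nat.coprime_lcm_div_lcm_div {m n : ℕ} (hm : 0 < m) (hn : 0 < n) :
    Nat.Coprime (Nat.lcm m n / m) (Nat.lcm m n / n) := by
  have h1 := Nat.div_mul_cancel (Nat.dvd_lcm_left m n)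
  have h2 := Nat.div_mul_cancel (Nat.dvd_lcm_right m n)
  have hg := Nat.gcd_mul_lcm m n
  have e1 : Nat.lcm m n / m = n / Nat.gcd m n := by
    refine (Nat.div_eq_of_eq_mul_left (Nat.gcd_pos_of_pos_left n hm) ?_).symm
    apply Nat.eq_of_mul_eq_mul_left hm
    nlinarith
  have e2 : Nat.lcm m n / n = m / Nat.gcd m n := by
    refine (Nat.div_eq_of_eq_mul_left (Nat.gcd_pos_of_pos_left n hm) ?_).symm
    apply Nat.eq_of_mul_eq_mul_left hn
    nlinarith
  rw [e1, e2]
  exact (Nat.coprime_div_gcd_div_gcd (Nat.gcd_pos_of_pos_left n hm)).symm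

theorem Int.gcd_eq_gcd_of_dvd_add {m x y : ℤ} (h : m ∣ x + y) :
    Int.gcd m x = Int.gcd m y := by
  obtain ⟨c, hc⟩ := h
  obtain rfl : x = -y + m * c := by linarith
  rw [Int.gcd_add_mul_left_right, Int.gcd_neg]

/-- The identity `d1·r1 = d2·r2 = d1·d2·r0` noted after Notation 3.3,
underlying the admissibility condition (hypothesis (A)). -/
theorem stmt0 (m1 m2 : ℕ) (hm1 : 0 < m1) (hm2 : 0 < m2) (a b : ℤ)
    (m3 d1 d2 : ℕ) (hm3 : m3 = Nat.lcm m1 m2) (hd1 : d1 = m3 / m1) (hd2 : d2 = m3 / m2)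
    (hA : (m3 : ℤ) ∣ (d1 : ℤ) * a + (d2 : ℤ) * b)
    (r1 r2 r0 : ℕ) (hr1 : r1 = Int.gcd (m1 : ℤ) a) (hr2 : r2 = Int.gcd (m2 : ℤ) b)
    (hr0 : r0 = Nat.gcd r1 r2) :
    d1 * r1 = d2 * r2 ∧ d1 * r1 = d1 * d2 * r0 := by
  have hcop : Nat.gcd d2 d1 = 1 := by
    rw [hd1, hd2, hm3]
    exact (Nat.coprime_lcm_div_lcm_div hm1 hm2).symm
  have h1 : (d1 : ℤ) * m1 = m3 := by
    exact_mod_cast hd1 ▸ Nat.div_mul_cancel (hm3 ▸ Nat.dvd_lcm_left m1 m2)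
  have h2 : (d2 : ℤ) * m2 = m3 := by
    exact_mod_cast hd2 ▸ Nat.div_mul_cancel (hm3 ▸ Nat.dvd_lcm_right m1 m2)
  have e1 : d1 * r1 = Int.gcd m3 (d1 * a) := by
    rw [hr1, ← h1, Int.gcd_mul_left, Int.natAbs_natCast]
  have e2 : d2 * r2 = Int.gcd m3 (d2 * b) := by
    rw [hr2, ← h2, Int.gcd_mul_left, Int.natAbs_natCast]
  have h : d1 * r1 = d2 * r2 := by rw [e1, e2, Int.gcd_eq_gcd_of_dvd_add hA]
  refine ⟨h, ?_⟩
  calc d1 * r1 = Nat.gcd d2 d1 * (d1 * r1) := by rw [hcop, one_mul]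
    _ = Nat.gcd (d2 * (d1 * r1)) (d1 * (d2 * r2)) := by rw [← h, Nat.gcd_mul_right]
    _ = Nat.gcd (d1 * d2 * r1) (d1 * d2 * r2) := by congr 1 <;> ring
    _ = d1 * d2 * r0 := by rw [Nat.gcd_mul_left, hr0]
end

section
/- Let γ1 = (m1, N1, a1) and γ2 = (m2, N2, a2) be monodromy data satisfying hypothesis (A), let γ3 = (m3, N3, a3) be the clutched datum, and let f1, f2, f3 denote the signatures of γ1, γ2, γ3. For n ∈ ℤ define δ(n) = 1 if m3 | d1·d2·r0·n, m3 ∤ d1·n, and m3 ∤ d2·n, and δ(n) = 0 otherwise. Then for every integer n with m3 ∤ n, one has f3(n) = f1(n) + f2(n) + δ(n). -/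
/-- `(m, N, a)` is a monodromy datum. -/
def IsMonodromyDatum (m N : ℕ) (a : ℕ → ℤ) : Prop :=
  2 ≤ m ∧ 3 ≤ N ∧
  (∀ i ∈ Finset.Icc 1 N, ¬ (m : ℤ) ∣ a i) ∧
  Nat.gcd m ((Finset.Icc 1 N).gcd fun i => (a i).natAbs) = 1 ∧
  (m : ℤ) ∣ ∑ i ∈ Finset.Icc 1 N, a i

/-- The signature `f(n) = −1 + Σ_{i=1}^N ⟨−n·a(i)/m⟩` if `m ∤ n`, and `0` if `m ∣ n`,
where `⟨x⟩` denotes the fractional part. -/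
def signature (m N : ℕ) (a : ℕ → ℤ) (n : ℤ) : ℚ :=
  if (m : ℤ) ∣ n then 0
  else -1 + ∑ i ∈ Finset.Icc 1 N, Int.fract (((-(n * a i) : ℤ) : ℚ) / (m : ℚ))

theorem Finset.sum_Icc_one_eq_sum_range {M : Type*} [AddCommMonoid M] (f : ℕ → M) (N : ℕ) :
    ∑ i ∈ Finset.Icc 1 N, f i = ∑ i ∈ Finset.range N, f (i + 1) := by
  induction N with
  | zero => simp
  | succ k ih => rw [Finset.sum_Icc_succ_top (by omega), ih, Finset.sum_range_succ]

theorem Int.fract_intCast_div_eq_zero_iff {m : ℕ} (hm : 0 < m) (a : ℤ) :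
    Int.fract ((a : ℚ) / (m : ℚ)) = 0 ↔ (m : ℤ) ∣ a := by
  have hm' : (m : ℚ) ≠ 0 := by positivity
  rw [Int.fract_eq_zero_iff]
  constructor
  · rintro ⟨z, hz⟩
    refine ⟨z, ?_⟩
    rw [eq_div_iff hm'] at hz
    have : z * (m : ℤ) = a := by exact_mod_cast hz
    rw [← this, mul_comm]
  · rintro ⟨z, rfl⟩
    refine ⟨z, ?_⟩
    push_cast
    field_simp

/-- The fractional parts of two rationals with integer sum add up to `0` or `1`. -/
theorem Int.fract_add_fract_of_add_eq_intCast {x y : ℚ} {z : ℤ} (h : x + y = z) :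
    Int.fract x + Int.fract y = if Int.fract x = 0 then 0 else 1 := by
  have hy : y = -x + z := by linarith
  rw [hy, Int.fract_add_intCast]
  split_ifs with hx
  · rw [Int.fract_neg_eq_zero.mpr hx, hx, add_zero]
  · rw [Int.fract_neg hx]
    ring

/-- If `d1 * m1 = d2 * m2` with `d1`, `d2` coprime, and `d1 * x + d2 * y` is divisible by this
common value, then `gcd m1 x = d2 * gcd (gcd m1 x) (gcd m2 y)`. -/
theorem Int.mul_gcd_gcd_eq_gcd_of_dvd_add {m1 m2 d1 d2 : ℕ} {x y : ℤ}
    (hm : d1 * m1 = d2 * m2) (hd : Nat.Coprime d1 d2)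
    (h : ((d1 * m1 : ℕ) : ℤ) ∣ (d1 : ℤ) * x + (d2 : ℤ) * y) :
    d2 * Nat.gcd (Int.gcd (m1 : ℤ) x) (Int.gcd (m2 : ℤ) y) = Int.gcd (m1 : ℤ) x := by
  have key : d1 * Int.gcd (m1 : ℤ) x = d2 * Int.gcd (m2 : ℤ) y := by
    have e1 : Int.gcd ((d1 : ℤ) * m1) ((d1 : ℤ) * x) = d1 * Int.gcd (m1 : ℤ) x := by
      simp [Int.gcd_mul_left]
    have e2 : Int.gcd ((d2 : ℤ) * m2) ((d2 : ℤ) * y) = d2 * Int.gcd (m2 : ℤ) y := by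
      simp [Int.gcd_mul_left]
    have hmz : (d1 : ℤ) * m1 = (d2 : ℤ) * m2 := by exact_mod_cast hm
    obtain ⟨z, hz⟩ := h
    push_cast at hz
    have hx : (d1 : ℤ) * x = -((d2 : ℤ) * y) + (d2 : ℤ) * m2 * z := by
      rw [← hmz]
      linarith
    rw [← e1, ← e2, hmz, hx]
    simp
  rw [← Nat.gcd_mul_left, ← key, Nat.gcd_mul_right, Nat.gcd_comm, hd.gcd_eq_one, one_mul]

/-- The signature of the clutched datum: `f3(n) = f1(n) + f2(n) + δ(n)` for `m3 ∤ n`,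
where `δ(n) = 1` iff `m3 ∣ d1·d2·r0·n`, `m3 ∤ d1·n` and `m3 ∤ d2·n`. -/
theorem stmt3 (m1 N1 m2 N2 : ℕ) (a1 a2 : ℕ → ℤ)
    (h1 : IsMonodromyDatum m1 N1 a1) (h2 : IsMonodromyDatum m2 N2 a2)
    (m3 d1 d2 N3 : ℕ) (a3 : ℕ → ℤ)
    (hm3 : m3 = Nat.lcm m1 m2) (hd1 : d1 = m3 / m1) (hd2 : d2 = m3 / m2)
    (hA : (m3 : ℤ) ∣ (d1 : ℤ) * a1 N1 + (d2 : ℤ) * a2 1)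
    (hN3 : N3 = N1 + N2 - 2)
    (ha3 : ∀ i, a3 i = if i ≤ N1 - 1 then (d1 : ℤ) * a1 i else (d2 : ℤ) * a2 (i - N1 + 2))
    (r1 r2 r0 : ℕ) (hr1 : r1 = Int.gcd (m1 : ℤ) (a1 N1)) (hr2 : r2 = Int.gcd (m2 : ℤ) (a2 1))
    (hr0 : r0 = Nat.gcd r1 r2)
    (δ : ℤ → ℚ)
    (hδ : ∀ n : ℤ, δ n =
      if (m3 : ℤ) ∣ (d1 : ℤ) * d2 * r0 * n ∧ ¬ (m3 : ℤ) ∣ (d1 : ℤ) * n ∧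
          ¬ (m3 : ℤ) ∣ (d2 : ℤ) * n then 1 else 0) :
    ∀ n : ℤ, ¬ (m3 : ℤ) ∣ n →
      signature m3 N3 a3 n = signature m1 N1 a1 n + signature m2 N2 a2 n + δ n := by
  intro n hn
  obtain ⟨hm1, hN1, -⟩ := h1
  obtain ⟨hm2, hN2, -⟩ := h2
  have hm3pos : 0 < m3 := hm3 ▸ Nat.lcm_pos (by omega) (by omega)
  have e1 : d1 * m1 = m3 := by rw [hd1, hm3, Nat.div_mul_cancel (Nat.dvd_lcm_left _ _)]
  have e2 : d2 * m2 = m3 := by rw [hd2, hm3, Nat.div_mul_cancel (Nat.dvd_lcm_right _ _)]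
  have hd1pos : 0 < d1 := Nat.pos_of_mul_pos_right (e1 ▸ hm3pos)
  have hd2pos : 0 < d2 := Nat.pos_of_mul_pos_right (e2 ▸ hm3pos)
  have hcop : Nat.Coprime d1 d2 := by
    have hg : 0 < Nat.gcd m1 m2 := Nat.gcd_pos_of_pos_left _ (by omega)
    have hgl : Nat.gcd m1 m2 * m3 = m1 * m2 := hm3 ▸ Nat.gcd_mul_lcm m1 m2
    have hd1' : d1 = m2 / Nat.gcd m1 m2 := by
      refine (Nat.div_eq_of_eq_mul_left hg (Nat.eq_of_mul_eq_mul_left (show 0 < m1 by omega) ?_)).symm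
      rw [← hgl, ← e1]
      ring
    have hd2' : d2 = m1 / Nat.gcd m1 m2 := by
      refine (Nat.div_eq_of_eq_mul_left hg (Nat.eq_of_mul_eq_mul_right (show 0 < m2 by omega) ?_)).symm
      rw [← hgl, ← e2]
      ring
    rw [hd1', hd2']
    exact (Nat.coprime_div_gcd_div_gcd hg).symm
  have hdvd1 (k : ℤ) : (m3 : ℤ) ∣ (d1 : ℤ) * k ↔ (m1 : ℤ) ∣ k := by
    rw [← e1]
    push_cast
    exact mul_dvd_mul_iff_left (by positivity)
  have hdvd2 (k : ℤ) : (m3 : ℤ) ∣ (d2 : ℤ) * k ↔ (m2 : ℤ) ∣ k := by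
    rw [← e2]
    push_cast
    exact mul_dvd_mul_iff_left (by positivity)
  have hq1 (k : ℤ) : ((-(n * (d1 * k)) : ℤ) : ℚ) / m3 = ((-(n * k) : ℤ) : ℚ) / m1 := by
    rw [← e1]
    push_cast
    field_simp
  have hq2 (k : ℤ) : ((-(n * (d2 * k)) : ℤ) : ℚ) / m3 = ((-(n * k) : ℤ) : ℚ) / m2 := by
    rw [← e2]
    push_cast
    field_simp
  have hr : d2 * r0 = r1 := by
    rw [hr0, hr1, hr2]
    exact Int.mul_gcd_gcd_eq_gcd_of_dvd_add (e1.trans e2.symm) hcop (e1 ▸ hA)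
  have hδ' : (m3 : ℤ) ∣ (d1 : ℤ) * d2 * r0 * n ↔ (m1 : ℤ) ∣ -(n * a1 N1) := by
    have : (d1 : ℤ) * d2 * r0 * n = d1 * (r1 * n) := by
      rw [← hr]
      push_cast
      ring
    rw [this, hdvd1, dvd_neg, mul_comm n, hr1, Int.coe_gcd, dvd_gcd_mul_iff_dvd_mul]
  obtain ⟨p, rfl⟩ : ∃ p, N1 = p + 1 := ⟨N1 - 1, by omega⟩
  obtain ⟨q, rfl⟩ : ∃ q, N2 = q + 1 := ⟨N2 - 1, by omega⟩
  obtain rfl : N3 = p + q := by omega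
  have hnode : Int.fract (((-(n * a1 (p + 1)) : ℤ) : ℚ) / m1) +
      Int.fract (((-(n * a2 1) : ℤ) : ℚ) / m2) =
        if (m1 : ℤ) ∣ -(n * a1 (p + 1)) then 0 else 1 := by
    obtain ⟨z, hz⟩ := hA
    have hsum : ((-(n * a1 (p + 1)) : ℤ) : ℚ) / m1 + ((-(n * a2 1) : ℤ) : ℚ) / m2 =
        ((-(n * z) : ℤ) : ℚ) := by
      rw [← hq1, ← hq2, ← add_div, div_eq_iff (by positivity)]
      have : -(n * ((d1 : ℤ) * a1 (p + 1))) + -(n * ((d2 : ℤ) * a2 1)) = -(n * z) * m3 := by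
        linear_combination (-n) * hz
      exact_mod_cast this
    rw [Int.fract_add_fract_of_add_eq_intCast hsum]
    simp only [Int.fract_intCast_div_eq_zero_iff (show 0 < m1 by omega)]
  have hsum3 : ∑ i ∈ Finset.Icc 1 (p + q), Int.fract (((-(n * a3 i) : ℤ) : ℚ) / m3) =
      ∑ i ∈ Finset.range p, Int.fract (((-(n * a1 (i + 1)) : ℤ) : ℚ) / m1) +
      ∑ i ∈ Finset.range q, Int.fract (((-(n * a2 (i + 1 + 1)) : ℤ) : ℚ) / m2) := by
    rw [Finset.sum_Icc_one_eq_sum_range, Finset.sum_range_add]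
    congr 1
    · refine Finset.sum_congr rfl fun i hi => ?_
      have := Finset.mem_range.mp hi
      rw [ha3, if_pos (by omega), hq1]
    · refine Finset.sum_congr rfl fun i _ => ?_
      rw [ha3, if_neg (by omega), hq2, show p + i + 1 - (p + 1) + 2 = i + 1 + 1 by omega]
  have hsum1 := Finset.sum_Icc_one_eq_sum_range
    (fun i => Int.fract (((-(n * a1 i) : ℤ) : ℚ) / m1)) (p + 1)
  rw [Finset.sum_range_succ] at hsum1
  have hsum2 := Finset.sum_Icc_one_eq_sum_range
    (fun i => Int.fract (((-(n * a2 i) : ℤ) : ℚ) / m2)) (q + 1)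
  rw [Finset.sum_range_succ', zero_add] at hsum2
  have hzero (m N : ℕ) (a : ℕ → ℤ) (hm : 0 < m) (h : (m : ℤ) ∣ n) :
      ∑ i ∈ Finset.Icc 1 N, Int.fract (((-(n * a i) : ℤ) : ℚ) / m) = 0 :=
    Finset.sum_eq_zero fun i _ =>
      (Int.fract_intCast_div_eq_zero_iff hm _).mpr (dvd_neg.mpr (h.mul_right _))
  have hnot : ¬ ((m1 : ℤ) ∣ n ∧ (m2 : ℤ) ∣ n) := fun ⟨h, h'⟩ =>
    hn (by rw [hm3]; exact_mod_cast Int.coe_lcm_dvd h h')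
  rw [hδ]
  simp only [signature, if_neg hn, hsum3, hdvd1, hdvd2, hδ']
  by_cases c1 : (m1 : ℤ) ∣ n
  · have c2 : ¬ (m2 : ℤ) ∣ n := fun c2 => hnot ⟨c1, c2⟩
    rw [if_pos (dvd_neg.mpr (c1.mul_right _))] at hnode
    have := hzero m1 (p + 1) a1 (by omega) c1
    simp only [c1, c2, not_true_eq_false, false_and, and_false, if_true, if_false]
    linarith
  · by_cases c2 : (m2 : ℤ) ∣ n
    · have hnode0 : (m1 : ℤ) ∣ -(n * a1 (p + 1)) := by
        have h2 : (m3 : ℤ) ∣ (d2 : ℤ) * (n * a2 1) := (hdvd2 _).mpr (c2.mul_right _)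
        rw [dvd_neg, ← hdvd1]
        have h3 : (d1 : ℤ) * (n * a1 (p + 1)) =
            n * (d1 * a1 (p + 1) + d2 * a2 1) - d2 * (n * a2 1) := by ring
        exact h3 ▸ dvd_sub (hA.mul_left n) h2
      rw [if_pos hnode0] at hnode
      have := hzero m2 (q + 1) a2 (by omega) c2
      simp only [c1, c2, not_true_eq_false, and_false, if_true, if_false]
      linarith
    · simp only [c1, c2, not_false_eq_true, and_true, if_false]
      split_ifs at hnode ⊢ <;> linarith
end

section
/- Let S be a nonempty finite set, let g1, g2 be natural numbers, let f1, f2 : S → ℕ satisfy f1(τ) ≤ g1 and f2(τ) ≤ g2 for all τ ∈ S, and let c ∈ {0, 1}. Set f3 = f1 + f2 + c (pointwise) and g3 = g1 + g2 + 2c. Then the multiset equality NP(f3, g3) = NP(f1, g1) + NP(f2, g2) + c·({#S} + {0}) holds (where c·({#S} + {0}) means c extra copies of the value #S and c extra copies of the value 0) if and only if the pair f1, f2 satisfies hypothesis (B). -/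
/-- `NP f g` is the multiset consisting, for each `j = 1, …, g`, of the count
`#{τ ∈ S : f(τ) ≥ j}` (encoding the μ-ordinary Newton polygon on an orbit). -/
def NP {S : Type*} [Fintype S] (f : S → ℕ) (g : ℕ) : Multiset ℕ :=
  (Finset.Icc 1 g).val.map fun j => (Finset.univ.filter fun τ : S => j ≤ f τ).card

/-- Hypothesis (B): the pair `f1, f2` is balanced. -/
def HypB {S : Type*} (f1 f2 : S → ℕ) : Prop :=
  ∀ ω τ : S, (f1 τ < f1 ω → f2 τ ≤ f2 ω) ∧ (f2 τ < f2 ω → f1 τ ≤ f1 ω)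

theorem NP_comp_equiv {S T : Type*} [Fintype S] [Fintype T] (e : T ≃ S) (f : S → ℕ) (g : ℕ) :
    NP (fun t => f (e t)) g = NP f g := by
  unfold NP
  refine Multiset.map_congr rfl fun j _ => ?_
  exact Finset.card_equiv e (by simp)

theorem Fin.le_card_filter_le_iff {n : ℕ} {a : Fin n → ℕ} (ha : Monotone a) (i : Fin n) (j : ℕ) :
    n - i ≤ (Finset.univ.filter fun t => j ≤ a t).card ↔ j ≤ a i := by
  constructor
  · intro h
    by_contra! hlt
    have hsub : (Finset.univ.filter fun t => j ≤ a t) ⊆ Finset.Ioi i := by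
      intro t ht
      rw [Finset.mem_filter] at ht
      rw [Finset.mem_Ioi]
      by_contra! hti
      exact absurd (ha hti) (by omega)
    have := Finset.card_le_card hsub
    rw [Fin.card_Ioi] at this
    omega
  · intro h
    rw [← Fin.card_Ici]
    refine Finset.card_le_card fun t ht => ?_
    rw [Finset.mem_Ici] at ht
    simpa using h.trans (ha ht)

theorem countP_NP_of_monotone {n g : ℕ} {a : Fin n → ℕ} (ha : Monotone a)
    (hg : ∀ i, a i ≤ g) (i : Fin n) :
    (NP a g).countP (n - i ≤ ·) = a i := by
  unfold NP
  rw [Multiset.countP_map]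
  simp only [Fin.le_card_filter_le_iff ha]
  rw [← Finset.filter_val, Finset.card_val]
  have : (Finset.Icc 1 g).filter (· ≤ a i) = Finset.Icc 1 (a i) := by
    ext j
    have := hg i
    simp only [Finset.mem_filter, Finset.mem_Icc]
    omega
  rw [this, Nat.card_Icc, Nat.add_sub_cancel]

theorem eq_of_NP_eq_of_monotone {n g : ℕ} {a b : Fin n → ℕ} (ha : Monotone a) (hb : Monotone b)
    (hag : ∀ i, a i ≤ g) (hbg : ∀ i, b i ≤ g) (h : NP a g = NP b g) : a = b := by
  ext i
  rw [← countP_NP_of_monotone ha hag, h, countP_NP_of_monotone hb hbg]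

theorem card_NP {S : Type*} [Fintype S] (f : S → ℕ) (g : ℕ) : (NP f g).card = g := by
  simp [NP]

theorem countP_NP_of_card_lt {S : Type*} [Fintype S] (f : S → ℕ) (g : ℕ) {k : ℕ}
    (hk : Fintype.card S < k) : (NP f g).countP (k ≤ ·) = 0 := by
  rw [Multiset.countP_eq_zero]
  intro x hx
  obtain ⟨j, -, rfl⟩ := Multiset.mem_map.1 hx
  exact not_le.2 ((Finset.card_le_univ _).trans_lt hk)

theorem Multiset.eq_of_countP_le_eq {M N : Multiset ℕ}
    (h : ∀ k, M.countP (k ≤ ·) = N.countP (k ≤ ·)) : M = N := by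
  have key (P : Multiset ℕ) (k : ℕ) :
      P.countP (k ≤ ·) = P.count k + P.countP (k + 1 ≤ ·) := by
    induction P using Multiset.induction with
    | empty => simp
    | cons x P ih =>
      simp only [Multiset.countP_cons, Multiset.count_cons, ih]
      split_ifs <;> omega
  ext k
  have := h k
  rw [key M, key N, h (k + 1)] at this
  exact Nat.add_right_cancel this

theorem NP_add_of_monotone {n g1 g2 : ℕ} {a b : Fin n → ℕ} (ha : Monotone a) (hb : Monotone b)
    (hag : ∀ i, a i ≤ g1) (hbg : ∀ i, b i ≤ g2) (c : ℕ) :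
    NP (fun i => a i + b i + c) (g1 + g2 + 2 * c) =
      NP a g1 + NP b g2 + Multiset.replicate c n + Multiset.replicate c 0 := by
  refine Multiset.eq_of_countP_le_eq fun k => ?_
  rcases Nat.eq_zero_or_pos k with rfl | hk
  · have hP (P : Multiset ℕ) : P.countP (0 ≤ ·) = P.card :=
      Multiset.countP_eq_card.2 fun _ _ => Nat.zero_le _
    rw [hP, hP]
    simp only [Multiset.card_add, card_NP, Multiset.card_replicate]
    ring
  have h0 : (Multiset.replicate c 0).countP (k ≤ ·) = 0 :=
    Multiset.countP_eq_zero.2 fun x hx => by rw [Multiset.eq_of_mem_replicate hx]; omega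
  simp only [Multiset.countP_add, h0, add_zero]
  rcases lt_or_ge n k with hnk | hkn
  · have hn : (Multiset.replicate c n).countP (k ≤ ·) = 0 :=
      Multiset.countP_eq_zero.2 fun x hx => by rw [Multiset.eq_of_mem_replicate hx]; omega
    have hcard : Fintype.card (Fin n) < k := by rwa [Fintype.card_fin]
    simp only [countP_NP_of_card_lt _ _ hcard, hn]
  · have hn : (Multiset.replicate c n).countP (k ≤ ·) = c := by
      rw [Multiset.countP_eq_card.2 fun x hx => by rwa [Multiset.eq_of_mem_replicate hx],
        Multiset.card_replicate]
    obtain ⟨i, rfl⟩ : ∃ i : Fin n, k = n - i := ⟨⟨n - k, by omega⟩, by simp only; omega⟩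
    have hab : Monotone fun i => a i + b i + c := (ha.add hb).add_const c
    rw [countP_NP_of_monotone hab fun i => by have := hag i; have := hbg i; omega,
      countP_NP_of_monotone ha hag, countP_NP_of_monotone hb hbg, hn]

theorem exists_equiv_monotone {S : Type*} [Fintype S] (f : S → ℕ) :
    ∃ e : Fin (Fintype.card S) ≃ S, Monotone fun i => f (e i) :=
  ⟨(Tuple.sort (f ∘ (Fintype.equivFin S).symm)).trans (Fintype.equivFin S).symm,
    Tuple.monotone_sort (f ∘ (Fintype.equivFin S).symm)⟩

theorem hypB_of_monovary {S : Type*} {f1 f2 : S → ℕ} (h : Monovary f1 f2) : HypB f1 f2 :=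
  fun _ _ => ⟨fun h1 => h.symm h1, fun h2 => h h2⟩

theorem monovary_of_sum_mul_eq {S : Type*} [Fintype S] {n : ℕ} {f1 f2 : S → ℕ}
    {e1 e2 : Fin n ≃ S} (h1 : Monotone fun i => f1 (e1 i)) (h2 : Monotone fun i => f2 (e2 i))
    (h : ∑ s, f1 s * f2 s = ∑ i, f1 (e1 i) * f2 (e2 i)) : Monovary f1 f2 := by
  have hm : Monovary (fun i => f1 (e1 i)) fun i => f2 (e2 i) := h1.monovary h2
  have key := (hm.sum_comp_perm_mul_eq_sum_mul_iff (σ := e2.trans e1.symm)).1 (by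
    rw [← h, ← e2.sum_comp]
    simp)
  intro s t hst
  simpa using @key (e2.symm s) (e2.symm t) (by simpa using hst)

/-- The Claim in the proof of Proposition 4.5: with `f3 = f1 + f2 + c` and
`g3 = g1 + g2 + 2c`, the multiset equality
`NP(f3, g3) = NP(f1, g1) + NP(f2, g2) + c·({#S} + {0})` holds iff `f1, f2`
satisfies hypothesis (B). -/
theorem stmt4 {S : Type*} [Fintype S] [Nonempty S] (g1 g2 : ℕ) (f1 f2 : S → ℕ)
    (hf1 : ∀ τ, f1 τ ≤ g1) (hf2 : ∀ τ, f2 τ ≤ g2) (c : ℕ) (hc : c = 0 ∨ c = 1) :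
    NP (fun τ => f1 τ + f2 τ + c) (g1 + g2 + 2 * c) =
      NP f1 g1 + NP f2 g2 +
        Multiset.replicate c (Fintype.card S) + Multiset.replicate c 0
    ↔ HypB f1 f2 := by
  constructor
  · intro h
    obtain ⟨e1, h1⟩ := exists_equiv_monotone f1
    obtain ⟨e2, h2⟩ := exists_equiv_monotone f2
    obtain ⟨e3, h3⟩ := exists_equiv_monotone fun τ => f1 τ + f2 τ + c
    have hsorted : (fun i => f1 (e3 i) + f2 (e3 i) + c) = fun i => f1 (e1 i) + f2 (e2 i) + c := by
      refine eq_of_NP_eq_of_monotone (g := g1 + g2 + 2 * c) h3 ((h1.add h2).add_const c)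
        (fun i => ?_) (fun i => ?_) ?_
      · have := hf1 (e3 i)
        have := hf2 (e3 i)
        omega
      · have := hf1 (e1 i)
        have := hf2 (e2 i)
        omega
      · rw [NP_comp_equiv e3 fun τ => f1 τ + f2 τ + c,
          NP_add_of_monotone h1 h2 (fun i => hf1 _) (fun i => hf2 _), NP_comp_equiv e1,
          NP_comp_equiv e2, h]
    have hsum : ∑ s, (f1 s + f2 s) ^ 2 = ∑ i, (f1 (e1 i) + f2 (e2 i)) ^ 2 := by
      rw [← e3.sum_comp]
      exact Finset.sum_congr rfl fun i _ => by
        rw [Nat.add_right_cancel (congrFun hsorted i)]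
    simp only [add_sq, Finset.sum_add_distrib, mul_assoc, ← Finset.mul_sum] at hsum
    rw [e1.sum_comp fun s => f1 s ^ 2, e2.sum_comp fun s => f2 s ^ 2] at hsum
    exact hypB_of_monovary (monovary_of_sum_mul_eq h1 h2 (by omega))
  · intro h
    obtain ⟨e, he⟩ := exists_equiv_monotone fun τ => f1 τ + f2 τ
    have h1 : Monotone fun i => f1 (e i) := fun i j hij => by
      by_contra! hlt
      have := (h (e i) (e j)).1 hlt
      have := he hij
      simp only at *
      omega
    have h2 : Monotone fun i => f2 (e i) := fun i j hij => by
      by_contra! hlt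
      have := (h (e i) (e j)).2 hlt
      have := he hij
      simp only at *
      omega
    rw [← NP_comp_equiv e, ← NP_comp_equiv e f1, ← NP_comp_equiv e f2]
    exact NP_add_of_monotone h1 h2 (fun i => hf1 _) (fun i => hf2 _) c
end

section
/- Let S be a nonempty finite set, let g1, g2 be natural numbers, and let f1, f2 : S → ℕ satisfy f1(τ) ≤ g1 and f2(τ) ≤ g2 for all τ ∈ S. Then the multiset equality NP(f1 + f2, g1 + g2) = NP(f1, g1) + NP(f2, g2) holds if and only if the pair f1, f2 satisfies hypothesis (B). -/
open Finset

/-- The symmetric biadditive pairing `∑ min x y` on multisets of natural numbers. -/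
def minPairing (M N : Multiset ℕ) : ℕ :=
  (M.map fun x => (N.map fun y => min x y).sum).sum

lemma minPairing_add_left (M M' N : Multiset ℕ) :
    minPairing (M + M') N = minPairing M N + minPairing M' N := by
  simp [minPairing]

lemma minPairing_comm (M N : Multiset ℕ) : minPairing M N = minPairing N M := by
  unfold minPairing
  rw [Multiset.sum_map_sum_map]
  simp only [min_comm]

lemma minPairing_add_right (M N N' : Multiset ℕ) :
    minPairing M (N + N') = minPairing M N + minPairing M N' := by
  rw [minPairing_comm, minPairing_add_left, minPairing_comm N, minPairing_comm N']

lemma HypB.symm {S : Type*} {f1 f2 : S → ℕ} (h : HypB f1 f2) : HypB f2 f1 :=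
  fun ω τ => (h ω τ).symm

lemma HypB.sub_one_left {S : Type*} {f1 f2 : S → ℕ} (h : HypB f1 f2) : HypB (fun τ => f1 τ - 1) f2 := by
  intro ω τ
  have := h ω τ
  dsimp only
  omega

lemma HypB.support_subset_or {S : Type*} {f1 f2 : S → ℕ} (h : HypB f1 f2) :
    (∀ τ, f1 τ = 0 → f2 τ = 0) ∨ (∀ τ, f2 τ = 0 → f1 τ = 0) := by
  by_contra! ⟨⟨τ, h1, h2⟩, ω, h3, h4⟩
  have := h ω τ
  omega

section LevelSets

variable {S : Type*} [Fintype S]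

lemma minPairing_NP (f1 f2 : S → ℕ) (g1 g2 : ℕ) :
    minPairing (NP f1 g1) (NP f2 g2) =
      ∑ j ∈ Icc 1 g1, ∑ k ∈ Icc 1 g2,
        min #{τ | j ≤ f1 τ} #{τ | k ≤ f2 τ} := by
  simp only [minPairing, NP, Multiset.map_map]
  rfl

lemma sum_ite_le_eq {a g : ℕ} (h : a ≤ g) :
    ∑ j ∈ Icc 1 g, (if j ≤ a then 1 else 0) = a := by
  rw [← card_filter, show (Icc 1 g).filter (· ≤ a) = Icc 1 a by ext; simp; omega]
  simp

lemma sum_card_levels_inter {g1 g2 : ℕ} {f1 f2 : S → ℕ}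
    (hf1 : ∀ τ, f1 τ ≤ g1) (hf2 : ∀ τ, f2 τ ≤ g2) :
    ∑ j ∈ Icc 1 g1, ∑ k ∈ Icc 1 g2, #{τ | j ≤ f1 τ ∧ k ≤ f2 τ} = ∑ τ, f1 τ * f2 τ := by
  calc
    _ = ∑ j ∈ Icc 1 g1, ∑ k ∈ Icc 1 g2, ∑ τ : S,
        (if j ≤ f1 τ then 1 else 0) * (if k ≤ f2 τ then 1 else 0) := by
      simp only [card_filter, ite_and, ite_mul, one_mul, zero_mul]
    _ = ∑ τ : S, (∑ j ∈ Icc 1 g1, if j ≤ f1 τ then 1 else 0) *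
        ∑ k ∈ Icc 1 g2, if k ≤ f2 τ then 1 else 0 := by
      simp only [sum_mul_sum]
      rw [eq_comm, sum_comm]
      exact sum_congr rfl fun _ _ => sum_comm
    _ = _ := sum_congr rfl fun τ _ => by
      rw [sum_ite_le_eq (hf1 τ), sum_ite_le_eq (hf2 τ)]

lemma minPairing_NP_self {g : ℕ} {f : S → ℕ} (hf : ∀ τ, f τ ≤ g) :
    minPairing (NP f g) (NP f g) = ∑ τ, f τ * f τ := by
  rw [minPairing_NP, ← sum_card_levels_inter hf hf]
  refine sum_congr rfl fun j _ => sum_congr rfl fun k _ => ?_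
  rcases le_total j k with h | h
  · rw [min_eq_right (card_le_card (monotone_filter_right _ fun _ _ h' => h.trans h'))]
    congr 1; ext; simp; omega
  · rw [min_eq_left (card_le_card (monotone_filter_right _ fun _ _ h' => h.trans h'))]
    congr 1; ext; simp; omega

lemma card_levels_inter_le_min (f1 f2 : S → ℕ) (j k : ℕ) :
    #{τ | j ≤ f1 τ ∧ k ≤ f2 τ} ≤ min #{τ | j ≤ f1 τ} #{τ | k ≤ f2 τ} :=
  le_min (card_le_card (monotone_filter_right _ fun _ _ h => h.1))
    (card_le_card (monotone_filter_right _ fun _ _ h => h.2))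

lemma card_levels_inter_lt_min {f1 f2 : S → ℕ} {ω τ : S}
    (h1 : f1 τ < f1 ω) (h2 : f2 ω < f2 τ) :
    #{σ | f1 ω ≤ f1 σ ∧ f2 τ ≤ f2 σ} < min #{σ | f1 ω ≤ f1 σ} #{σ | f2 τ ≤ f2 σ} := by
  refine lt_min (card_lt_card ?_) (card_lt_card ?_)
  · refine (ssubset_iff_of_subset (monotone_filter_right _ fun _ _ h => h.1)).2 ⟨ω, ?_⟩
    simp [h2]
  · refine (ssubset_iff_of_subset (monotone_filter_right _ fun _ _ h => h.2)).2 ⟨τ, ?_⟩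
    simp [h1]

lemma le_of_NP_add_of_lt {g1 g2 : ℕ} {f1 f2 : S → ℕ}
    (hf1 : ∀ τ, f1 τ ≤ g1) (hf2 : ∀ τ, f2 τ ≤ g2)
    (h : NP (fun τ => f1 τ + f2 τ) (g1 + g2) = NP f1 g1 + NP f2 g2) {ω τ : S}
    (h1 : f1 τ < f1 ω) : f2 τ ≤ f2 ω := by
  by_contra! h2
  have hself := minPairing_NP_self (f := fun τ => f1 τ + f2 τ) (g := g1 + g2)
    fun τ => add_le_add (hf1 τ) (hf2 τ)
  have hexpand : ∑ τ, (f1 τ + f2 τ) * (f1 τ + f2 τ) =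
      ∑ τ, f1 τ * f1 τ + 2 * ∑ τ, f1 τ * f2 τ + ∑ τ, f2 τ * f2 τ := by
    rw [mul_sum, ← sum_add_distrib, ← sum_add_distrib]
    exact sum_congr rfl fun _ _ => by ring
  rw [h, minPairing_add_left, minPairing_add_right, minPairing_add_right,
    minPairing_NP_self hf1, minPairing_NP_self hf2, minPairing_comm (NP f2 g2), hexpand] at hself
  have hcross : ∑ τ, f1 τ * f2 τ = minPairing (NP f1 g1) (NP f2 g2) := by omega
  rw [minPairing_NP, ← sum_card_levels_inter hf1 hf2] at hcross
  refine hcross.not_lt (sum_lt_sum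
    (fun j _ => sum_le_sum fun k _ => card_levels_inter_le_min f1 f2 j k)
    ⟨f1 ω, mem_Icc.2 ⟨by omega, hf1 ω⟩, sum_lt_sum
      (fun k _ => card_levels_inter_le_min f1 f2 _ k)
      ⟨f2 τ, mem_Icc.2 ⟨by omega, hf2 τ⟩, card_levels_inter_lt_min h1 h2⟩⟩)

lemma NP_zero_right (f : S → ℕ) : NP f 0 = 0 := by simp [NP]

lemma NP_succ (f : S → ℕ) (g : ℕ) :
    NP f (g + 1) = #{τ | 1 ≤ f τ} ::ₘ NP (fun τ => f τ - 1) g := by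
  have hIcc : Icc 1 (g + 1) = cons 1 ((Icc 1 g).map (addRightEmbedding 1)) (by simp) := by
    ext
    rw [mem_cons, map_add_right_Icc, mem_Icc, mem_Icc]
    omega
  simp only [NP, hIcc, cons_val, Multiset.map_cons, map_val, Multiset.map_map]
  congr 1
  refine Multiset.map_congr rfl fun j hj => ?_
  simp only [Function.comp_apply, addRightEmbedding_apply]
  congr 1
  ext τ
  have := (Finset.mem_Icc.1 (Finset.mem_def.2 hj)).1
  simp only [mem_filter_univ]
  omega

lemma NP_add_succ_left {g1 g2 : ℕ} {f1 f2 : S → ℕ} (hs : ∀ τ, f1 τ = 0 → f2 τ = 0)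
    (ih : NP (fun τ => f1 τ - 1 + f2 τ) (g1 + g2) = NP (fun τ => f1 τ - 1) g1 + NP f2 g2) :
    NP (fun τ => f1 τ + f2 τ) (g1 + 1 + g2) = NP f1 (g1 + 1) + NP f2 g2 := by
  rw [show g1 + 1 + g2 = g1 + g2 + 1 by ring, NP_succ, NP_succ f1, Multiset.cons_add, ← ih]
  congr 2
  · ext τ
    have := hs τ
    simp; omega
  · funext τ
    have := hs τ
    omega

lemma HypB.NP_add {g1 g2 : ℕ} {f1 f2 : S → ℕ} (hf1 : ∀ τ, f1 τ ≤ g1) (hf2 : ∀ τ, f2 τ ≤ g2)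
    (h : HypB f1 f2) : NP (fun τ => f1 τ + f2 τ) (g1 + g2) = NP f1 g1 + NP f2 g2 := by
  induction hn : g1 + g2 generalizing g1 g2 f1 f2 with
  | zero =>
    obtain ⟨rfl, rfl⟩ : g1 = 0 ∧ g2 = 0 := by omega
    simp [NP_zero_right]
  | succ n ih =>
    wlog hs : ∀ τ, f1 τ = 0 → f2 τ = 0 generalizing f1 f2 g1 g2
    · have := this hf2 hf1 h.symm (by omega) (h.support_subset_or.resolve_left hs)
      simpa only [add_comm] using this
    rw [← hn]
    cases g1 with
    | zero =>
      have h0 : ∀ τ, f1 τ = 0 := fun τ => Nat.le_zero.1 (hf1 τ)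
      simp [h0, NP_zero_right]
    | succ g1 =>
      refine NP_add_succ_left hs ?_
      rw [show g1 + g2 = n by omega]
      exact ih (fun τ => by have := hf1 τ; omega) hf2 h.sub_one_left (by omega)

end LevelSets

/-- The Specialized claim in the proof of Proposition 4.5:
`NP(f1 + f2, g1 + g2) = NP(f1, g1) + NP(f2, g2)` iff `f1, f2` satisfies
hypothesis (B). -/
theorem stmt5 {S : Type*} [Fintype S] [Nonempty S] (g1 g2 : ℕ) (f1 f2 : S → ℕ)
    (hf1 : ∀ τ, f1 τ ≤ g1) (hf2 : ∀ τ, f2 τ ≤ g2) :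
    NP (fun τ => f1 τ + f2 τ) (g1 + g2) = NP f1 g1 + NP f2 g2 ↔ HypB f1 f2 := by
  refine ⟨fun h ω τ => ⟨le_of_NP_add_of_lt hf1 hf2 h, fun h2 => ?_⟩, HypB.NP_add hf1 hf2⟩
  by_contra! h1
  exact h2.not_ge (le_of_NP_add_of_lt hf1 hf2 h h1)
end

section
/- Let S be a finite set, let g and c be natural numbers, and let f : S → ℕ satisfy f(τ) ≤ g for all τ ∈ S. Then NP(f + c, g + 2c) = NP(f, g) + c·{#S} + c·{0}, i.e. the multiset NP(f + c, g + 2c) is obtained from NP(f, g) by adding c copies of the value #S and c copies of the value 0. -/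
theorem NP_eq_map_range {S : Type*} [Fintype S] (f : S → ℕ) (g : ℕ) :
    NP f g = (Multiset.range g).map
      fun j => (Finset.univ.filter fun τ : S => j + 1 ≤ f τ).card := by
  have h : Finset.Icc 1 g = (Finset.range g).map (addRightEmbedding 1) := by
    ext j
    simp only [Finset.mem_Icc, Finset.mem_map, Finset.mem_range, addRightEmbedding_apply]
    exact ⟨fun hj => ⟨j - 1, by omega, by omega⟩, by rintro ⟨i, hi, rfl⟩; omega⟩
  rw [NP, h, Finset.map_val, Multiset.map_map]
  rfl

theorem Multiset.map_range_eq_replicate {α : Type*} {n : ℕ} {h : ℕ → α} {a : α}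
    (ha : ∀ i < n, h i = a) : (Multiset.range n).map h = Multiset.replicate n a := by
  rw [Multiset.eq_replicate]
  refine ⟨by simp, fun b hb => ?_⟩
  obtain ⟨i, hi, rfl⟩ := Multiset.mem_map.1 hb
  exact ha i (Multiset.mem_range.1 hi)

/-- Adding `c` to both the signature and the bound adds `c` copies of `#S`. -/
theorem NP_add_const {S : Type*} [Fintype S] (f : S → ℕ) (g c : ℕ) :
    NP (fun τ => f τ + c) (c + g) = NP f g + Multiset.replicate c (Fintype.card S) := by
  rw [NP_eq_map_range, NP_eq_map_range, Multiset.range_add, Multiset.map_add, Multiset.map_map,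
    add_comm]
  congr 1
  · refine Multiset.map_congr rfl fun j _ => ?_
    have h (τ : S) : c + j + 1 ≤ f τ + c ↔ j + 1 ≤ f τ := by omega
    simp only [Function.comp_apply, h]
  · refine Multiset.map_range_eq_replicate fun i hi => ?_
    rw [Finset.filter_true_of_mem fun τ _ => by omega, Finset.card_univ]

/-- Raising the bound by `c` adds `c` copies of `0`. -/
theorem NP_add_right {S : Type*} [Fintype S] (f : S → ℕ) (g c : ℕ) (hf : ∀ τ, f τ ≤ g) :
    NP f (g + c) = NP f g + Multiset.replicate c 0 := by
  rw [NP_eq_map_range, NP_eq_map_range, Multiset.range_add, Multiset.map_add, Multiset.map_map]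
  congr 1
  refine Multiset.map_range_eq_replicate fun i _ => ?_
  rw [Function.comp_apply, Finset.card_eq_zero]
  refine Finset.filter_false_of_mem fun τ _ => ?_
  have := hf τ
  omega

/-- Equality (5.5) in the proof of Proposition 4.5: increasing the signature by a
constant `c` adds `c` copies of `#S` and `c` copies of `0` to `NP`. -/
theorem stmt6 {S : Type*} [Fintype S] (g c : ℕ) (f : S → ℕ) (hf : ∀ τ, f τ ≤ g) :
    NP (fun τ => f τ + c) (g + 2 * c) =
      NP f g + Multiset.replicate c (Fintype.card S) + Multiset.replicate c 0 := by
  have h : g + 2 * c = c + (g + c) := by ring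
  rw [h, NP_add_const, NP_add_right f g c hf, add_right_comm]
end

section
/- Let S be a nonempty finite set, let g ≥ 1 be a natural number, and let f : S → ℕ satisfy f(τ) ≤ g for all τ ∈ S. Then the function j ↦ #{τ ∈ S : f(τ) ≥ j} takes at most two distinct values on {1, …, g} if and only if there exists a natural number E with 0 ≤ E ≤ g such that f(τ) ∈ {0, E, g} for every τ ∈ S. -/
/-- The superlevel count `j ↦ #{τ : j ≤ f τ}` drops strictly between `i` and `j` as soon as `f` takes
a value in `[i, j)`. -/
theorem card_superlevel_lt {S : Type*} [Fintype S] {f : S → ℕ} {i j : ℕ} {τ : S}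
    (hi : i ≤ f τ) (hj : f τ < j) :
    (Finset.univ.filter fun τ : S => j ≤ f τ).card <
      (Finset.univ.filter fun τ : S => i ≤ f τ).card := by
  refine Finset.card_lt_card (Finset.ssubset_iff_of_subset ?_ |>.2 ⟨τ, ?_, ?_⟩)
  · intro x hx
    simp only [Finset.mem_filter, Finset.mem_univ, true_and] at hx ⊢
    omega
  · simpa using hi
  · simpa using hj

/-- If `f` takes two distinct values strictly between `0` and `g`, its superlevel count takes at least
three values on `{1, …, g}`. -/
theorem two_lt_card_image_superlevel {S : Type*} [Fintype S] {g : ℕ} {f : S → ℕ} {σ τ : S}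
    (hσ : 0 < f σ) (hστ : f σ < f τ) (hτ : f τ < g) :
    2 < ((Finset.Icc 1 g).image fun j =>
      (Finset.univ.filter fun τ : S => j ≤ f τ).card).card := by
  have h₁ := card_superlevel_lt (f := f) (le_refl (f σ)) hστ
  have h₂ := card_superlevel_lt (f := f) (le_refl (f τ)) hτ
  refine Finset.two_lt_card.2 ⟨_, Finset.mem_image_of_mem _ (Finset.mem_Icc.2 ⟨hσ, by omega⟩),
    _, Finset.mem_image_of_mem _ (Finset.mem_Icc.2 ⟨by omega, hτ.le⟩),
    _, Finset.mem_image_of_mem _ (Finset.mem_Icc.2 ⟨by omega, le_refl g⟩),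
    h₁.ne', (h₂.trans h₁).ne', h₂.ne'⟩

/-- Lemma 6.6 (combinatorial content): the slope function
`j ↦ #{τ : f(τ) ≥ j}` takes at most two distinct values on `{1, …, g}` iff there is
`E ∈ [0, g]` with `f(τ) ∈ {0, E, g}` for every `τ`. -/
theorem stmt12 {S : Type*} [Fintype S] [Nonempty S] (g : ℕ) (hg : 1 ≤ g)
    (f : S → ℕ) (hf : ∀ τ, f τ ≤ g) :
    ((Finset.Icc 1 g).image fun j => (Finset.univ.filter fun τ : S => j ≤ f τ).card).card ≤ 2
    ↔ ∃ E : ℕ, E ≤ g ∧ ∀ τ : S, f τ = 0 ∨ f τ = E ∨ f τ = g := by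
  constructor
  · intro h
    by_cases hmid : ∃ σ, 0 < f σ ∧ f σ < g
    · obtain ⟨σ, hσ, hσg⟩ := hmid
      refine ⟨f σ, hσg.le, fun τ => ?_⟩
      by_contra! hτ
      obtain ⟨hτ₀, hτσ, hτg⟩ := hτ
      have hle := hf τ
      rcases lt_or_gt_of_ne hτσ with hlt | hlt
      · exact h.not_gt (two_lt_card_image_superlevel (Nat.pos_of_ne_zero hτ₀) hlt hσg)
      · exact h.not_gt (two_lt_card_image_superlevel hσ hlt (lt_of_le_of_ne hle hτg))
    · push Not at hmid
      refine ⟨0, g.zero_le, fun τ => ?_⟩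
      have hle := hf τ
      have hmid' := hmid τ
      omega
  · rintro ⟨E, hE, h⟩
    refine (Finset.card_le_card ?_).trans (Finset.card_le_two
      (a := (Finset.univ.filter fun τ : S => E ≤ f τ).card)
      (b := (Finset.univ.filter fun τ : S => g ≤ f τ).card))
    intro c hc
    obtain ⟨j, hj, rfl⟩ := Finset.mem_image.1 hc
    rw [Finset.mem_Icc] at hj
    rw [Finset.mem_insert, Finset.mem_singleton]
    rcases le_or_gt j E with hjE | hjE
    · left
      congr 1
      refine Finset.filter_congr fun τ _ => ?_
      have hτ := h τ
      omega
    · right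
      congr 1
      refine Finset.filter_congr fun τ _ => ?_
      have hτ := h τ
      omega
end

section
/- Let S be a nonempty finite set, let g1, g2 be natural numbers, and let f1, f2 : S → ℕ satisfy f1(τ) ≤ g1 and f2(τ) ≤ g2 for all τ. Then the following are equivalent: (i) for every j ∈ {1, …, g1}, either #{τ : f1(τ) ≥ j} ≤ #{τ : f2(τ) = g2} or #{τ : f1(τ) ≥ j} ≥ #{τ : f2(τ) > 0}; (ii) there exists a natural number E with 0 ≤ E ≤ g1 such that #{τ : f1(τ) > E} ≤ #{τ : f2(τ) = g2} and #{τ : f1(τ) ≥ E} ≥ #{τ : f2(τ) > 0}. -/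
/-- The characterization of hypothesis (C) on an orbit, Remark 6.3: every slope of
the polygon of `f1` avoids the open interval between the first and last slopes of the
polygon of `f2` iff there is a threshold `E ∈ [0, g1]` as in (ii). -/
theorem stmt13 {S : Type*} [Fintype S] [Nonempty S] (g1 g2 : ℕ) (f1 f2 : S → ℕ)
    (hf1 : ∀ τ, f1 τ ≤ g1) (hf2 : ∀ τ, f2 τ ≤ g2) :
    (∀ j ∈ Finset.Icc 1 g1,
        (Finset.univ.filter fun τ : S => j ≤ f1 τ).card ≤
            (Finset.univ.filter fun τ : S => f2 τ = g2).card ∨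
          (Finset.univ.filter fun τ : S => 0 < f2 τ).card ≤
            (Finset.univ.filter fun τ : S => j ≤ f1 τ).card)
    ↔ ∃ E : ℕ, E ≤ g1 ∧
        (Finset.univ.filter fun τ : S => E < f1 τ).card ≤
          (Finset.univ.filter fun τ : S => f2 τ = g2).card ∧
        (Finset.univ.filter fun τ : S => 0 < f2 τ).card ≤
          (Finset.univ.filter fun τ : S => E ≤ f1 τ).card := by
  classical
  constructor
  · intro h
    have h_zero : (Finset.univ.filter fun τ : S => 0 < f2 τ).card ≤
        (Finset.univ.filter fun τ : S => 0 ≤ f1 τ).card :=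
      Finset.card_le_card fun τ _ => by simp
    let P : ℕ → Prop := fun E => (Finset.univ.filter fun τ : S => 0 < f2 τ).card ≤
      (Finset.univ.filter fun τ : S => E ≤ f1 τ).card
    have h_spec : P (Nat.findGreatest P g1) := Nat.findGreatest_spec (Nat.zero_le g1) h_zero
    have h_le : Nat.findGreatest P g1 ≤ g1 := Nat.findGreatest_le g1
    refine ⟨Nat.findGreatest P g1, h_le, ?_, h_spec⟩
    rcases h_le.eq_or_lt with h_eq | h_lt
    · rw [h_eq, Finset.filter_false_of_mem fun τ _ => (hf1 τ).not_gt]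
      simp
    · have h_not : ¬ P (Nat.findGreatest P g1 + 1) :=
        Nat.findGreatest_is_greatest (Nat.lt_succ_self _) h_lt
      exact (h (Nat.findGreatest P g1 + 1) (Finset.mem_Icc.2 ⟨by omega, h_lt⟩)).resolve_right
        h_not
  · rintro ⟨E, -, h_first, h_last⟩ j -
    rcases le_or_gt j E with hj | hj
    · exact Or.inr (h_last.trans (Finset.card_le_card
        (Finset.monotone_filter_right _ fun τ _ hτ => hj.trans hτ)))
    · exact Or.inl ((Finset.card_le_card
        (Finset.monotone_filter_right _ fun τ _ hτ => hj.trans_le hτ)).trans h_first)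
end
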